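/- arXiv:math/0611543 — 2 statements merged into one kernel-verified Lean document; each statement's English description precedes it below -/
import Mathlib

section
/- Suppose r_L and r_U satisfy r̃₂/2 < r_L < r_U and η′(r_U) + 12η′(2r_L) ≥ 0. If Φ ∈ ℝ^{2N+1} satisfies η(r_L) + 4η(2r_L) − 2η(2r_U) < Φ_j < η(r_U) + 4η(2r_U) − 2η(2r_L) for every j = −N,…,N, then the equation Ψ̂^F(r) = Φ has exactly one solution r in Ω = (r_L, r_U)^{2N+1}. -/
open Finset Set

noncomputable section

/-- The `j`-th component (for `j ∈ [-N, N]`) of a vector in `ℝ^{2N+1}`. -/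
def vcomp (N : ℕ) (r : Fin (2*N+1) → ℝ) (j : ℤ) : ℝ :=
  if h : (j + N).toNat < 2*N+1 then r ⟨(j + N).toNat, h⟩ else 0

/-- `η̂(r) = η(r) + 2 η(2r)`, the derivative of the energy density. -/
def etaHat (η : ℝ → ℝ) : ℝ → ℝ := fun r => η r + 2 * η (2*r)

/-- Structural assumptions on the atomistic potential (with `η = φ'`). -/
def Assump (η : ℝ → ℝ) (r1 r2 a0 a1 : ℝ) : Prop :=
  0 < a0 ∧ a0 < r1 ∧ r1 < r2 ∧ r2 < 2*a0 ∧ a0 < a1 ∧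
  (∀ r ∈ Ioo (0:ℝ) r1, 0 < deriv η r) ∧ (∀ r ∈ Ioi r1, deriv η r < 0) ∧
  (∀ r ∈ Ioo (0:ℝ) r2, deriv (deriv η) r < 0) ∧ (∀ r ∈ Ioi r2, 0 < deriv (deriv η) r) ∧
  (∀ r ∈ Ioo (0:ℝ) a0, etaHat η r < 0) ∧ (∀ r ∈ Ioi a0, 0 < etaHat η r) ∧
  (∀ r ∈ Ioo (0:ℝ) a1, 0 < deriv (etaHat η) r) ∧ (∀ r ∈ Ioi a1, deriv (etaHat η) r < 0)

/-- The symmetrized force-based quasicontinuum conjugate-force map `Ψ̂^F`. -/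
def PsiF (N K : ℕ) (η : ℝ → ℝ) (r : Fin (2*N+1) → ℝ) : Fin (2*N+1) → ℝ := fun i =>
  let j : ℤ := (i.val : ℤ) - (N : ℤ)
  let c := vcomp N r
  if -(K:ℤ)+1 ≤ j ∧ j ≤ (K:ℤ)-1 then
    η (c j) + η (c j + c (j-1)) + η (c j + c (j+1))
      + 2 * η (2 * c (K:ℤ)) - η (c (K:ℤ) + c ((K:ℤ)-1)) - η (c (K:ℤ) + c ((K:ℤ)+1))
  else η (c j) + 2 * η (2 * c j)

/-- The symmetrized energy-based quasicontinuum conjugate-force map `Ψ̂^E`. -/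
def PsiE (N K : ℕ) (η : ℝ → ℝ) (r : Fin (2*N+1) → ℝ) : Fin (2*N+1) → ℝ := fun i =>
  let j : ℤ := (i.val : ℤ) - (N : ℤ)
  let c := vcomp N r
  if j = -(K:ℤ)-1 then η (c j) + 2*η (2*c j) + (1/2)*η (c j + c (j+1))
  else if j = (K:ℤ)+1 then η (c j) + 2*η (2*c j) + (1/2)*η (c (j-1) + c j)
  else if j = -(K:ℤ) ∨ j = (K:ℤ) then
    η (c j) + η (2*c j) + (1/2)*η (c j + c (j-1)) + (1/2)*η (c j + c (j+1))
  else if j = -(K:ℤ)+1 then η (c j) + (1/2)*η (c j + c (j-1)) + η (c j + c (j+1))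
  else if j = (K:ℤ)-1 then η (c j) + η (c j + c (j-1)) + (1/2)*η (c j + c (j+1))
  else if -(K:ℤ)+2 ≤ j ∧ j ≤ (K:ℤ)-2 then η (c j) + η (c j + c (j-1)) + η (c j + c (j+1))
  else η (c j) + 2*η (2*c j)

/-- The ghost-force correction map `Ψ̂^G = Ψ̂^F - Ψ̂^E`. -/
def PsiG (N K : ℕ) (η : ℝ → ℝ) (r : Fin (2*N+1) → ℝ) : Fin (2*N+1) → ℝ :=
  fun i => PsiF N K η r i - PsiE N K η r i

/-- The force-based quasicontinuum forces, with `r` given as a `ℤ`-indexed family. -/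
def FQCFr (N K : ℕ) (η : ℝ → ℝ) (r : ℤ → ℝ) (j : ℤ) : ℝ :=
  if j = -(N:ℤ) then η (r j) + 2*η (2*r j)
  else if j = (N:ℤ)+1 then -(η (r (j-1)) + 2*η (2*r (j-1)))
  else if -(K:ℤ)+1 ≤ j ∧ j ≤ (K:ℤ) then
    (η (r j) + η (r j + r (j+1))) - (η (r (j-1)) + η (r (j-1) + r (j-2)))
  else (η (r j) + 2*η (2*r j)) - (η (r (j-1)) + 2*η (2*r (j-1)))

/-- The Jacobian matrix of `Ψ̂^F`. -/
def Jac (N K : ℕ) (η : ℝ → ℝ) (r : Fin (2*N+1) → ℝ) :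
    Matrix (Fin (2*N+1)) (Fin (2*N+1)) ℝ :=
  fun i j => deriv (fun t => PsiF N K η (Function.update r j t) i) (r j)

/-- Strict diagonal dominance with positive diagonal. -/
def SDD {m : ℕ} (A : Matrix (Fin m) (Fin m) ℝ) : Prop :=
  ∀ i, 0 < A i i ∧ ∑ j ∈ Finset.univ.erase i, |A i j| < A i i

/-- A vector `r ∈ ℝ^{2N+1}` is symmetric if `r_{-j} = r_j` for `1 ≤ j ≤ N`. -/
def SymVec (N : ℕ) (r : Fin (2*N+1) → ℝ) : Prop :=
  ∀ j : ℤ, 1 ≤ j → j ≤ (N:ℤ) → vcomp N r (-j) = vcomp N r j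


/-- If `f` is strictly expanding with factor `c` on `[a, b]`, `R` is `c`-Lipschitz in the sup norm,
and `f (x i) + R x i` crosses `Φ i` between the faces `x i = a` and `x i = b` of the box, then
`f (x i) + R x i = Φ i` has exactly one solution in the open box. -/
theorem existsUnique_add_eq_of_lipschitz {ι : Type*} [Fintype ι]
    {f : ℝ → ℝ} {R : (ι → ℝ) → ι → ℝ} {Φ : ι → ℝ} {a b c M : ℝ} (hab : a < b)
    (hM : 0 < M) (hcM : c ≤ M)
    (hf : ∀ s ∈ Icc a b, ∀ t ∈ Icc a b, s < t →
      c * (t - s) < f t - f s ∧ f t - f s ≤ M * (t - s))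
    (hR : ∀ x y : ι → ℝ, (∀ k, x k ∈ Icc a b) → (∀ k, y k ∈ Icc a b) →
      ∀ i, |R x i - R y i| ≤ c * dist x y)
    (hlow : ∀ x : ι → ℝ, (∀ k, x k ∈ Icc a b) → ∀ i, f a + R x i < Φ i)
    (hupp : ∀ x : ι → ℝ, (∀ k, x k ∈ Icc a b) → ∀ i, Φ i < f b + R x i) :
    ∃! x : ι → ℝ, (∀ k, x k ∈ Ioo a b) ∧ ∀ i, f (x i) + R x i = Φ i := by
  set τ : ℝ := 1 / (2 * M) with hτ
  have hτ0 : 0 < τ := by positivity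
  have hτM : τ * M = 1 / 2 := by rw [hτ]; field_simp
  have hτc : τ * c ≤ 1 / 2 := hτM ▸ mul_le_mul_of_nonneg_left hcM hτ0.le
  set T : (ι → ℝ) → ι → ℝ :=
    fun x i => max a (min b (x i - τ * (f (x i) + R x i - Φ i))) with hT
  have hTbox (x : ι → ℝ) (k : ι) : T x k ∈ Icc a b :=
    ⟨le_max_left _ _, max_le hab.le (min_le_left _ _)⟩
  have hclamp (u v : ℝ) : |max a (min b u) - max a (min b v)| ≤ |u - v| :=
    (abs_max_sub_max_le_max a _ a _).trans <| by
      simpa using (abs_min_sub_min_le_max b u b v)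
  have hstep (x y : ι → ℝ) (hx : ∀ k, x k ∈ Icc a b) (hy : ∀ k, y k ∈ Icc a b)
      (hxy : 0 < dist x y) (i : ι) (hle : y i ≤ x i) :
      |(x i - τ * (f (x i) + R x i - Φ i)) - (y i - τ * (f (y i) + R y i - Φ i))|
        < dist x y := by
    have hd : x i - y i ≤ dist x y :=
      (le_abs_self _).trans ((Real.dist_eq _ _).symm.le.trans (dist_le_pi_dist x y i))
    have hRi := abs_le.1 (hR x y hx hy i)
    have hRl := mul_le_mul_of_nonneg_left hRi.1 hτ0.le
    have hRu := mul_le_mul_of_nonneg_left hRi.2 hτ0.le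
    have hτcD := mul_le_mul_of_nonneg_right hτc hxy.le
    rcases hle.eq_or_lt with heq | hlt
    · rw [abs_lt, heq]
      constructor <;> nlinarith
    · obtain ⟨hfl, hfu⟩ := hf _ (hy i) _ (hx i) hlt
      have hfl := mul_lt_mul_of_pos_left hfl hτ0
      have hfu := mul_le_mul_of_nonneg_left hfu hτ0.le
      have hMd : τ * (M * (x i - y i)) = 1 / 2 * (x i - y i) := by rw [← mul_assoc, hτM]
      have hcd : 0 ≤ (1 - τ * c) * (dist x y - (x i - y i)) :=
        mul_nonneg (by linarith) (by linarith)
      rw [abs_lt]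
      constructor <;> nlinarith
  have hcontr (x y : ι → ℝ) (hx : ∀ k, x k ∈ Icc a b) (hy : ∀ k, y k ∈ Icc a b)
      (hxy : x ≠ y) : dist (T x) (T y) < dist x y := by
    have hpos := dist_pos.2 hxy
    refine (dist_pi_lt_iff hpos).2 fun i => ?_
    rw [Real.dist_eq]
    refine (hclamp _ _).trans_lt ?_
    rcases le_total (y i) (x i) with h | h
    · exact hstep x y hx hy hpos i h
    · rw [abs_sub_comm, dist_comm x y]
      exact hstep y x hy hx (by rwa [dist_comm]) i h
  have hfix (x : ι → ℝ) (hx : ∀ k, x k ∈ Ioo a b) (h : ∀ i, f (x i) + R x i = Φ i) :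
      T x = x := by
    funext i
    simp [hT, h i, (hx i).1.le, (hx i).2.le]
  have hcompact : IsCompact (Set.univ.pi fun _ : ι => Icc a b) :=
    isCompact_univ_pi fun _ => isCompact_Icc
  have hTcont : ContinuousOn T (Set.univ.pi fun _ : ι => Icc a b) := by
    refine (LipschitzOnWith.of_dist_le_mul (K := 1) fun x hx y hy => ?_).continuousOn
    rcases eq_or_ne x y with rfl | hne
    · simp
    · simpa using (hcontr x y (fun k => hx k trivial) (fun k => hy k trivial) hne).le
  obtain ⟨x, hxs, hmin⟩ := hcompact.exists_isMinOn
    ⟨fun _ => a, fun _ _ => Set.left_mem_Icc.2 hab.le⟩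
    (continuous_dist.comp_continuousOn (continuousOn_id.prodMk hTcont))
  have hx : ∀ k, x k ∈ Icc a b := fun k => hxs k trivial
  have hTx : T x = x := by
    by_contra hne
    have hle : dist x (T x) ≤ dist (T x) (T (T x)) := hmin fun k _ => hTbox x k
    exact absurd (hcontr x (T x) hx (hTbox x) (Ne.symm hne)) hle.not_gt
  have hsol (i : ι) : x i ∈ Ioo a b ∧ f (x i) + R x i = Φ i := by
    have hi : max a (min b (x i - τ * (f (x i) + R x i - Φ i))) = x i := congrFun hTx i
    have hl := hlow x hx i
    have hu := hupp x hx i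
    have hgt : a < x i := by
      refine (hx i).1.lt_of_ne fun h => ?_
      rw [← h] at hi
      have hneg : τ * (f a + R x i - Φ i) < 0 := mul_neg_of_pos_of_neg hτ0 (by linarith)
      have : a < min b (a - τ * (f a + R x i - Φ i)) := lt_min hab (by linarith)
      exact this.not_ge (max_eq_left_iff.1 hi)
    have hlt : x i < b := by
      refine (hx i).2.lt_of_ne fun h => ?_
      rw [h] at hi
      have hpos : 0 < τ * (f b + R x i - Φ i) := mul_pos hτ0 (by linarith)
      have : max a (min b (b - τ * (f b + R x i - Φ i))) < b :=
        max_lt hab ((min_le_right _ _).trans_lt (by linarith))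
      exact this.ne hi
    refine ⟨⟨hgt, hlt⟩, ?_⟩
    have hstat : τ * (f (x i) + R x i - Φ i) = 0 := by
      rcases max_choice a (min b (x i - τ * (f (x i) + R x i - Φ i))) with h | h
      · exact absurd (h.symm.trans hi) hgt.ne
      · rcases min_choice b (x i - τ * (f (x i) + R x i - Φ i)) with h' | h'
        · exact absurd (h'.symm.trans (h.symm.trans hi)) hlt.ne'
        · linarith [h'.symm.trans (h.symm.trans hi)]
    linarith [(mul_eq_zero.1 hstat).resolve_left hτ0.ne']
  refine ⟨x, ⟨fun k => (hsol k).1, fun i => (hsol i).2⟩, fun y hy => ?_⟩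
  by_contra hne
  have hlt := hcontr y x (fun k => Set.Ioo_subset_Icc_self (hy.1 k)) hx hne
  rw [hfix y hy.1 hy.2, hTx] at hlt
  exact hlt.false

theorem vcomp_sub_natCast (N : ℕ) (r : Fin (2*N+1) → ℝ) (i : Fin (2*N+1)) :
    vcomp N r ((i.val : ℤ) - N) = r i := by
  have := i.isLt
  simp [vcomp]
  omega

theorem exists_vcomp_eq (N : ℕ) {j : ℤ} (hj : -(N:ℤ) ≤ j) (hj' : j ≤ N) :
    ∃ k, ∀ r : Fin (2*N+1) → ℝ, vcomp N r j = r k := by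
  have h : (j + N).toNat < 2*N+1 := by omega
  exact ⟨⟨_, h⟩, fun r => by simp [vcomp, h]⟩

/-- Under the structural assumptions, `η` is strictly expanding with factor `-12 η'(2 r_L)` on
`[r_L, r_U]` and decreasing with slope at least `η'(2 r_L)` on `[2 r_L, ∞)`. -/
theorem Assump.slope_bounds {φ η : ℝ → ℝ} (hφ : ContDiffOn ℝ 3 φ (Set.Ioi 0))
    (hη : η = deriv φ) {r1 r2 a0 a1 : ℝ} (hA : Assump η r1 r2 a0 a1)
    {rL rU : ℝ} (h1 : r2/2 < rL) (h2 : rL < rU)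
    (h3 : 0 ≤ deriv η rU + 12 * deriv η (2*rL)) :
    deriv η (2*rL) < 0 ∧ deriv η rU < deriv η rL ∧
    (∀ s ∈ Icc rL rU, ∀ t ∈ Icc rL rU, s < t →
      12 * -deriv η (2*rL) * (t - s) < η t - η s ∧ η t - η s ≤ deriv η rL * (t - s)) ∧
    (∀ s t, 2*rL ≤ s → s ≤ t → η t ≤ η s ∧ η s - η t ≤ -deriv η (2*rL) * (t - s)) := by
  obtain ⟨ha0, har, hr12, -, -, -, hneg, hconc, hconv, -⟩ := hA
  have hη2 : ContDiffOn ℝ 2 η (Ioi 0) := by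
    rw [hη]; exact hφ.deriv_of_isOpen isOpen_Ioi (by norm_num)
  have hη1 : ContDiffOn ℝ 1 (deriv η) (Ioi 0) := hη2.deriv_of_isOpen isOpen_Ioi (by norm_num)
  have hdiff : DifferentiableOn ℝ η (Ioi 0) := hη2.differentiableOn (by norm_num)
  have hm : deriv η (2*rL) < 0 := hneg _ (by rw [Set.mem_Ioi]; linarith)
  have hrU : rU ≤ r1 := by
    by_contra! h
    linarith [hneg rU h]
  have hsub : Icc rL rU ⊆ Ioi 0 := fun x hx => by rw [Set.mem_Ioi]; linarith [hx.1]
  have hsub' : Ici (2*rL) ⊆ Ioi 0 := fun x hx => by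
    rw [Set.mem_Ioi]; rw [Set.mem_Ici] at hx; linarith
  have hanti : StrictAntiOn (deriv η) (Icc rL rU) := by
    refine strictAntiOn_of_deriv_neg (convex_Icc _ _) (hη1.continuousOn.mono hsub) fun x hx => ?_
    rw [interior_Icc] at hx
    exact hconc x ⟨by linarith [hx.1], by linarith [hx.2]⟩
  have hmono : StrictMonoOn (deriv η) (Ici (2*rL)) := by
    refine strictMonoOn_of_deriv_pos (convex_Ici _) (hη1.continuousOn.mono hsub') fun x hx => ?_
    rw [interior_Ici, Set.mem_Ioi] at hx
    exact hconv x (by rw [Set.mem_Ioi]; linarith)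
  have hL := Set.left_mem_Icc.2 h2.le
  have hU := Set.right_mem_Icc.2 h2.le
  refine ⟨hm, hanti hL hU h2, fun s hs t ht hst => ⟨?_, ?_⟩, fun s t hs hst => ⟨?_, ?_⟩⟩
  · refine (convex_Icc rL rU).mul_sub_lt_image_sub_of_lt_deriv (hdiff.continuousOn.mono hsub)
      (hdiff.mono (interior_subset.trans hsub)) (fun x hx => ?_) s hs t ht hst
    rw [interior_Icc] at hx
    linarith [hanti (Set.Ioo_subset_Icc_self hx) hU hx.2]
  · refine (convex_Icc rL rU).image_sub_le_mul_sub_of_deriv_le (hdiff.continuousOn.mono hsub)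
      (hdiff.mono (interior_subset.trans hsub)) (fun x hx => ?_) s hs t ht hst.le
    rw [interior_Icc] at hx
    exact (hanti hL (Set.Ioo_subset_Icc_self hx) hx.1).le
  · have := (convex_Ici (2*rL)).image_sub_le_mul_sub_of_deriv_le (C := 0)
      (hdiff.continuousOn.mono hsub') (hdiff.mono (interior_subset.trans hsub'))
      (fun x hx => ?_) s hs t (hs.trans hst) hst
    · linarith
    · rw [interior_Ici, Set.mem_Ioi] at hx
      exact (hneg x (by rw [Set.mem_Ioi]; linarith)).le
  · have := (convex_Ici (2*rL)).mul_sub_le_image_sub_of_le_deriv (C := deriv η (2*rL))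
      (hdiff.continuousOn.mono hsub') (hdiff.mono (interior_subset.trans hsub'))
      (fun x hx => ?_) s hs t (hs.trans hst) hst
    · linarith
    · rw [interior_Ici, Set.mem_Ioi] at hx
      exact (hmono Set.self_mem_Ici (Set.mem_Ici.2 hx.le) hx).le

/-- Theorem 4.5 (existence and uniqueness for the force-based quasicontinuum system):
if `r̃₂/2 < r_L < r_U`, `η'(r_U) + 12η'(2r_L) ≥ 0`, and each `Φ_j` lies strictly between
`η(r_L) + 4η(2r_L) - 2η(2r_U)` and `η(r_U) + 4η(2r_U) - 2η(2r_L)`, then `Ψ̂^F(r) = Φ` has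
exactly one solution in `Ω = (r_L, r_U)^{2N+1}`. -/
theorem psiF_unique_solution
    (N K : ℕ) (hK : 2 ≤ K) (hKN : K + 2 ≤ N)
    (φ η : ℝ → ℝ) (hφ : ContDiffOn ℝ 3 φ (Set.Ioi 0)) (hη : η = deriv φ)
    (r1 r2 a0 a1 : ℝ) (hA : Assump η r1 r2 a0 a1)
    (rL rU : ℝ) (h1 : r2/2 < rL) (h2 : rL < rU)
    (h3 : 0 ≤ deriv η rU + 12 * deriv η (2*rL))
    (Φ : Fin (2*N+1) → ℝ)
    (hΦ : ∀ j, η rL + 4*η (2*rL) - 2*η (2*rU) < Φ j ∧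
               Φ j < η rU + 4*η (2*rU) - 2*η (2*rL)) :
    ∃! r : Fin (2*N+1) → ℝ, (∀ k, r k ∈ Ioo rL rU) ∧ PsiF N K η r = Φ := by
  obtain ⟨hm, hUL, hexp, hdec⟩ := hA.slope_bounds hφ hη h1 h2 h3
  set m : ℝ := -deriv η (2*rL) with hmdef
  have hm0 : 0 < m := by linarith
  have hsum {p q : ℝ} (hp : p ∈ Icc rL rU) (hq : q ∈ Icc rL rU) :
      η (2*rU) ≤ η (p + q) ∧ η (p + q) ≤ η (2*rL) :=
    ⟨(hdec _ _ (by linarith [hp.1, hq.1]) (by linarith [hp.2, hq.2])).1,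
      (hdec _ _ le_rfl (by linarith [hp.1, hq.1])).1⟩
  have hlip {x y : Fin (2*N+1) → ℝ} (hx : ∀ k, x k ∈ Icc rL rU) (hy : ∀ k, y k ∈ Icc rL rU)
      (k l : Fin (2*N+1)) : |η (x k + x l) - η (y k + y l)| ≤ 2 * (m * dist x y) := by
    have hk := (Real.dist_eq (x k) (y k)).symm.le.trans (dist_le_pi_dist x y k)
    have hl := (Real.dist_eq (x l) (y l)).symm.le.trans (dist_le_pi_dist x y l)
    rw [abs_le] at hk hl
    have hxk := (hx k).1
    have hxl := (hx l).1
    have hyk := (hy k).1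
    have hyl := (hy l).1
    rw [abs_le]
    rcases le_total (x k + x l) (y k + y l) with h | h
    · obtain ⟨hlo, hup⟩ := hdec _ _ (by linarith) h
      constructor <;> nlinarith
    · obtain ⟨hlo, hup⟩ := hdec _ _ (by linarith) h
      constructor <;> nlinarith
  set R : (Fin (2*N+1) → ℝ) → Fin (2*N+1) → ℝ := fun x i => PsiF N K η x i - η (x i) with hRdef
  have hcases (i : Fin (2*N+1)) :
      (∀ x, R x i = 2 * η (x i + x i)) ∨
      ∃ p q k k₁ k₂, ∀ x, R x i = η (x i + x p) + η (x i + x q) + 2 * η (x k + x k)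
        - η (x k + x k₁) - η (x k + x k₂) := by
    by_cases hi : -(K:ℤ)+1 ≤ (i.val : ℤ) - N ∧ (i.val : ℤ) - N ≤ (K:ℤ)-1
    · right
      obtain ⟨p, hp⟩ := exists_vcomp_eq N (j := (i.val : ℤ) - N - 1) (by omega) (by omega)
      obtain ⟨q, hq⟩ := exists_vcomp_eq N (j := (i.val : ℤ) - N + 1) (by omega) (by omega)
      obtain ⟨k, hk⟩ := exists_vcomp_eq N (j := (K:ℤ)) (by omega) (by omega)
      obtain ⟨k₁, hk₁⟩ := exists_vcomp_eq N (j := (K:ℤ) - 1) (by omega) (by omega)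
      obtain ⟨k₂, hk₂⟩ := exists_vcomp_eq N (j := (K:ℤ) + 1) (by omega) (by omega)
      refine ⟨p, q, k, k₁, k₂, fun x => ?_⟩
      simp only [hRdef, PsiF, if_pos hi, vcomp_sub_natCast, hp, hq, hk, hk₁, hk₂, two_mul (x k)]
      ring
    · left
      intro x
      simp only [hRdef, PsiF, if_neg hi, vcomp_sub_natCast, two_mul (x i)]
      ring
  have hbound {x : Fin (2*N+1) → ℝ} (hx : ∀ k, x k ∈ Icc rL rU) (i : Fin (2*N+1)) :
      4 * η (2*rU) - 2 * η (2*rL) ≤ R x i ∧ R x i ≤ 4 * η (2*rL) - 2 * η (2*rU) := by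
    rcases hcases i with h | ⟨p, q, k, k₁, k₂, h⟩
    · have h₁ := hsum (hx i) (hx i)
      rw [h x]
      constructor <;> linarith [h₁.1, h₁.2]
    · obtain ⟨h₁, h₁'⟩ := hsum (hx i) (hx p)
      obtain ⟨h₂, h₂'⟩ := hsum (hx i) (hx q)
      obtain ⟨h₃, h₃'⟩ := hsum (hx k) (hx k)
      obtain ⟨h₄, h₄'⟩ := hsum (hx k) (hx k₁)
      obtain ⟨h₅, h₅'⟩ := hsum (hx k) (hx k₂)
      rw [h x]
      constructor <;> linarith
  have hmain := existsUnique_add_eq_of_lipschitz (R := R) (Φ := Φ) (c := 12 * m)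
    (M := deriv η rL) h2 (by linarith) (by linarith) hexp
    (fun x y hx hy i => by
      have hD : 0 ≤ m * dist x y := by positivity
      rcases hcases i with h | ⟨p, q, k, k₁, k₂, h⟩
      · have h₁ := abs_le.1 (hlip hx hy i i)
        rw [h x, h y, abs_le]
        constructor <;> linarith [h₁.1, h₁.2]
      · obtain ⟨h₁, h₁'⟩ := abs_le.1 (hlip hx hy i p)
        obtain ⟨h₂, h₂'⟩ := abs_le.1 (hlip hx hy i q)
        obtain ⟨h₃, h₃'⟩ := abs_le.1 (hlip hx hy k k)
        obtain ⟨h₄, h₄'⟩ := abs_le.1 (hlip hx hy k k₁)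
        obtain ⟨h₅, h₅'⟩ := abs_le.1 (hlip hx hy k k₂)
        rw [h x, h y, abs_le]
        constructor <;> linarith)
    (fun x hx i => by linarith [(hbound hx i).2, (hΦ i).1])
    (fun x hx i => by linarith [(hbound hx i).1, (hΦ i).2])
  simpa only [hRdef, add_sub_cancel, funext_iff] using hmain
end
end

section
/- Let φ be the Lennard-Jones potential φ(r) = r^{−12} − 2r^{−6}, and let r̃₂ = (13/4)^{1/6} and a₁ = (53261/29120)^{1/6}. Assume the external forces f_j are anti-symmetric. For any r_U with r̃₂/2 < r_U < a₁, set r_L = max( r̃₂/2, (63/(16η′(r_U)))^{1/8} ). If r_L < r_U, then whenever η(r_L) + 4η(2r_L) − 2η(2r_U) < Φ_j < η(r_U) + 4η(2r_U) − 2η(2r_L) for every j = −N,…,N, the equilibrium equations F^{QCF}_j(r) + f_j = 0 for j = −N,…,N+1 have exactly one symmetric solution r in Ω = (r_L, r_U)^{2N+1}. -/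
open Finset Set

noncomputable section

/-- A strongly increasing function of each coordinate, perturbed by a coupling term with a smaller
Lipschitz constant, attains every value for which no coordinate can leave the box, exactly once. -/
theorem existsUnique_of_diagonal_dominance {ι : Type*} [Fintype ι] {g : ℝ → ℝ} {a b L C : ℝ}
    (hab : a ≤ b) (hC : 0 ≤ C) (hCL : C < L) (hgc : ContinuousOn g (Set.Icc a b))
    (hg : ∀ x ∈ Set.Icc a b, ∀ y ∈ Set.Icc a b, x ≤ y → L * (y - x) ≤ g y - g x)
    (R : (ι → ℝ) → ι → ℝ) (v : ι → ℝ)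
    (hR : ∀ x y : ι → ℝ, (∀ i, x i ∈ Set.Icc a b) → (∀ i, y i ∈ Set.Icc a b) →
      ∀ i, |R x i - R y i| ≤ C * dist x y)
    (hv : ∀ x : ι → ℝ, (∀ i, x i ∈ Set.Icc a b) → ∀ i, v i - R x i ∈ Set.Ioo (g a) (g b)) :
    ∃! x : ι → ℝ, (∀ i, x i ∈ Set.Ioo a b) ∧ ∀ i, g (x i) + R x i = v i := by
  have hL : 0 < L := hC.trans_lt hCL
  have hCL1 : C / L < 1 := (div_lt_one hL).2 hCL
  have expand : ∀ x ∈ Set.Icc a b, ∀ y ∈ Set.Icc a b, L * |x - y| ≤ |g x - g y| := by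
    intro x hx y hy
    rcases le_total x y with h | h
    · rw [abs_sub_comm x y, abs_sub_comm (g x), abs_of_nonneg (sub_nonneg.2 h)]
      exact (hg x hx y hy h).trans (le_abs_self _)
    · rw [abs_of_nonneg (sub_nonneg.2 h)]
      exact (hg y hy x hx h).trans (le_abs_self _)
  have contract : ∀ x y x' y' : ι → ℝ, (∀ i, x i ∈ Set.Icc a b) → (∀ i, y i ∈ Set.Icc a b) →
      (∀ i, x' i ∈ Set.Icc a b) → (∀ i, y' i ∈ Set.Icc a b) →
      (∀ i, g (x' i) + R x i = v i) → (∀ i, g (y' i) + R y i = v i) →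
      dist x' y' ≤ C / L * dist x y := by
    intro x y x' y' hx hy hx' hy' ex ey
    refine (dist_pi_le_iff (mul_nonneg (div_nonneg hC hL.le) dist_nonneg)).2 fun i => ?_
    have h1 := expand _ (hx' i) _ (hy' i)
    have h2 := hR x y hx hy i
    rw [show g (x' i) - g (y' i) = -(R x i - R y i) by linarith [ex i, ey i], abs_neg] at h1
    rw [Real.dist_eq, div_mul_eq_mul_div, le_div_iff₀ hL]
    linarith
  have solve : ∀ x : ι → ℝ, ∃ x' : ι → ℝ, (∀ i, x i ∈ Set.Icc a b) →
      (∀ i, x' i ∈ Set.Ioo a b) ∧ ∀ i, g (x' i) + R x i = v i := by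
    intro x
    by_cases hx : ∀ i, x i ∈ Set.Icc a b
    · choose z hz hz' using fun i => intermediate_value_Ioo hab hgc (hv x hx i)
      exact ⟨z, fun _ => ⟨hz, fun i => by linarith [hz' i]⟩⟩
    · exact ⟨x, fun h => absurd h hx⟩
  choose T hT using solve
  have sub : ∀ {x : ι → ℝ}, (∀ i, x i ∈ Set.Ioo a b) → ∀ i, x i ∈ Set.Icc a b :=
    fun h i => Set.Ioo_subset_Icc_self (h i)
  let S : Set (ι → ℝ) := Set.univ.pi fun _ => Set.Icc a b
  have hS : ∀ {x : ι → ℝ}, x ∈ S ↔ ∀ i, x i ∈ Set.Icc a b := fun {x} => by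
    simp only [S, Set.mem_univ_pi]
  have hcl : IsClosed S := isClosed_set_pi fun _ _ => isClosed_Icc
  have : CompleteSpace S := hcl.completeSpace_coe
  have : Nonempty S := ⟨⟨fun _ => a, hS.2 fun _ => ⟨le_rfl, hab⟩⟩⟩
  let U : S → S := fun x => ⟨T x, hS.2 (sub (hT x (hS.1 x.2)).1)⟩
  have hU : ContractingWith (C / L).toNNReal U := by
    refine ⟨by simpa using hCL1, LipschitzWith.of_dist_le_mul fun x y => ?_⟩
    rw [Real.coe_toNNReal _ (div_nonneg hC hL.le)]
    have hx := hT x (hS.1 x.2)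
    have hy := hT y (hS.1 y.2)
    exact contract x y (T x) (T y) (hS.1 x.2) (hS.1 y.2) (sub hx.1) (sub hy.1) hx.2 hy.2
  obtain ⟨p, hp⟩ : ∃ p : S, U p = p := ⟨_, hU.fixedPoint_isFixedPt⟩
  have hp' : T p = p := congrArg Subtype.val hp
  have hpT := hT p (hS.1 p.2)
  rw [hp'] at hpT
  refine ⟨p, hpT, fun y hy => ?_⟩
  have h := contract y p y p (sub hy.1) (sub hpT.1) (sub hy.1) (sub hpT.1) hy.2 hpT.2
  have h0 : dist y (p : ι → ℝ) = 0 := by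
    nlinarith [dist_nonneg (x := y) (y := (p : ι → ℝ))]
  exact dist_eq_zero.1 h0

/-- The next-nearest-neighbour part of the conjugate force at bond `j`. -/
def farForce (K : ℕ) (η : ℝ → ℝ) (c : ℤ → ℝ) (j : ℤ) : ℝ :=
  if -(K:ℤ)+1 ≤ j ∧ j ≤ (K:ℤ)-1 then
    η (c j + c (j-1)) + η (c j + c (j+1))
      + 2 * η (2 * c (K:ℤ)) - η (c (K:ℤ) + c ((K:ℤ)-1)) - η (c (K:ℤ) + c ((K:ℤ)+1))
  else 2 * η (2 * c j)

theorem farForce_neg {K : ℕ} {η : ℝ → ℝ} {c : ℤ → ℝ} (hc : ∀ j, c (-j) = c j) (j : ℤ) :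
    farForce K η c (-j) = farForce K η c j := by
  have h1 : c (-j - 1) = c (j + 1) := by rw [← hc (j + 1)]; congr 1; ring
  have h2 : c (-j + 1) = c (j - 1) := by rw [← hc (j - 1)]; congr 1; ring
  unfold farForce
  rw [hc, h1, h2]
  by_cases h : -(K:ℤ)+1 ≤ j ∧ j ≤ (K:ℤ)-1
  · rw [if_pos h, if_pos (by omega)]; ring
  · rw [if_neg h, if_neg (by omega)]

/-- The quasicontinuum forces on interior atoms are differences of conjugate forces. -/
theorem FQCFr_eq_sub {N K : ℕ} (hK : 1 ≤ K) {η : ℝ → ℝ} {c : ℤ → ℝ}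
    (hc : ∀ j, c (-j) = c j) {j : ℤ} (h1 : -(N:ℤ) < j) (h2 : j ≤ N) :
    FQCFr N K η c j =
      (η (c j) + farForce K η c j) - (η (c (j-1)) + farForce K η c (j-1)) := by
  unfold FQCFr farForce
  rw [if_neg (by omega), if_neg (by omega)]
  by_cases hj : -(K:ℤ)+1 ≤ j ∧ j ≤ (K:ℤ)
  · rw [if_pos hj]
    by_cases hl : j = -(K:ℤ)+1
    · subst hl
      rw [if_pos (by omega), if_neg (by omega)]
      have e1 : c (-(K:ℤ)+1-1) = c K := by rw [← hc K]; congr 1; ring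
      have e2 : c (-(K:ℤ)+1-2) = c (K+1) := by rw [← hc (K+1)]; congr 1; ring
      have e3 : c (-(K:ℤ)+1) = c (K-1) := by rw [← hc (K-1)]; congr 1; ring
      rw [e1, e2, e3, add_comm (c K) (c (K-1))]
      ring
    · by_cases hr : j = K
      · subst hr
        rw [if_neg (by omega), if_pos (by omega), show (K:ℤ)-1+1 = K by ring,
          show (K:ℤ)-1-1 = K-2 by ring, add_comm (c K) (c (K-1))]
        ring
      · rw [if_pos (by omega), if_pos (by omega), show j-1+1 = j by ring,
          show j-1-1 = j-2 by ring, add_comm (c (j-1)) (c j)]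
        ring
  · rw [if_neg hj, if_neg (by omega), if_neg (by omega)]

theorem sum_Icc_int_sub {f : ℤ → ℝ} {a b : ℤ} (h : a ≤ b) :
    ∑ i ∈ Finset.Icc a b, f i = ∑ i ∈ Finset.Icc a (b-1), f i + f b := by
  have : Finset.Icc a b = insert b (Finset.Icc a (b-1)) := by
    ext i; simp only [Finset.mem_insert, Finset.mem_Icc]; omega
  rw [this, Finset.sum_insert (by simp), add_comm]

/-- Partial sums of anti-symmetric forces are symmetric. -/
theorem sum_Icc_neg_eq {f : ℤ → ℝ} {N : ℕ}
    (hanti : ∀ j : ℤ, 0 ≤ j → j ≤ (N:ℤ) → f (j+1) = - f (-j)) (k : ℕ) (hk : k ≤ N) :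
    ∑ i ∈ Finset.Icc (-(N:ℤ)) (-(k:ℤ)), f i = ∑ i ∈ Finset.Icc (-(N:ℤ)) k, f i := by
  induction k with
  | zero => simp
  | succ k ih =>
    have h1 := sum_Icc_int_sub (f := f) (a := -(N:ℤ)) (b := -(k:ℤ)) (by omega)
    have h2 := sum_Icc_int_sub (f := f) (a := -(N:ℤ)) (b := (k:ℤ)+1) (by omega)
    rw [show (k:ℤ)+1-1 = k by ring] at h2
    rw [show -(k:ℤ)-1 = -((k:ℤ)+1) by ring] at h1
    push_cast
    linarith [ih (by omega), hanti k (by omega) (by omega)]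

/-- Equilibrium is equivalent to the balance of internal and external conjugate forces. -/
theorem equilibrium_iff {N K : ℕ} (hK : 1 ≤ K) (hKN : K < N) {η : ℝ → ℝ} {c f : ℤ → ℝ}
    (hc : ∀ j, c (-j) = c j)
    (hsum : ∑ j ∈ Finset.Icc (-(N:ℤ)) ((N:ℤ)+1), f j = 0)
    (hanti : ∀ j : ℤ, 0 ≤ j → j ≤ (N:ℤ) → f (j+1) = - f (-j)) :
    (∀ j : ℤ, -(N:ℤ) ≤ j → j ≤ (N:ℤ)+1 → FQCFr N K η c j + f j = 0) ↔
      ∀ k : ℕ, k ≤ N → η (c k) + farForce K η c k = -∑ i ∈ Finset.Icc (-(N:ℤ)) k, f i := by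
  have first : FQCFr N K η c (-(N:ℤ)) = η (c (-(N:ℤ))) + farForce K η c (-(N:ℤ)) := by
    unfold FQCFr farForce
    rw [if_pos rfl, if_neg (by omega)]
  constructor
  · intro h
    have key : ∀ m : ℕ, m ≤ 2*N → η (c (m - N)) + farForce K η c (m - N)
        = -∑ i ∈ Finset.Icc (-(N:ℤ)) (m - N), f i := by
      intro m
      induction m with
      | zero =>
        intro _
        have := h (-(N:ℤ)) le_rfl (by omega)
        simp only [Nat.cast_zero, zero_sub, Finset.Icc_self, Finset.sum_singleton]
        linarith
      | succ m ih =>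
        intro hm
        have h1 := h ((m+1:ℕ) - (N:ℤ)) (by omega) (by omega)
        rw [FQCFr_eq_sub hK hc (by omega) (by omega)] at h1
        have h2 := sum_Icc_int_sub (f := f) (a := -(N:ℤ)) (b := (m+1:ℕ) - (N:ℤ)) (by omega)
        have e : ((m+1:ℕ):ℤ) - N - 1 = m - N := by push_cast; ring
        rw [e] at h1 h2
        linarith [ih (by omega)]
    intro k hk
    have := key (k + N) (by omega)
    rwa [show ((k + N : ℕ) : ℤ) - N = k by push_cast; ring] at this
  · intro h
    have key : ∀ j : ℤ, -(N:ℤ) ≤ j → j ≤ N → η (c j) + farForce K η c j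
        = -∑ i ∈ Finset.Icc (-(N:ℤ)) j, f i := by
      intro j h1 h2
      obtain ⟨k, rfl | rfl⟩ := j.eq_nat_or_neg
      · exact h k (by omega)
      · rw [hc, farForce_neg hc, sum_Icc_neg_eq hanti k (by omega)]
        exact h k (by omega)
    intro j h1 h2
    rcases h1.eq_or_lt with rfl | h1
    · rw [first, key _ le_rfl (by omega)]
      simp
    rcases h2.eq_or_lt with rfl | h2
    · have h3 := key N (by omega) le_rfl
      have h4 := sum_Icc_int_sub (f := f) (a := -(N:ℤ)) (b := (N:ℤ)+1) (by omega)
      rw [show (N:ℤ)+1-1 = N by ring, hsum] at h4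
      unfold farForce at h3
      rw [if_neg (by omega)] at h3
      unfold FQCFr
      rw [if_neg (by omega), if_pos rfl, show (N:ℤ)+1-1 = N by ring]
      linarith
    · rw [FQCFr_eq_sub hK hc h1 (by omega), key j h1.le (by omega),
        key (j-1) (by omega) (by omega)]
      linarith [sum_Icc_int_sub (f := f) h1.le]

theorem FQCFr_congr {N K : ℕ} (hKN : K < N) {η : ℝ → ℝ} {c d : ℤ → ℝ}
    (hcd : ∀ j : ℤ, -(N:ℤ) ≤ j → j ≤ N → c j = d j) {j : ℤ}
    (h1 : -(N:ℤ) ≤ j) (h2 : j ≤ N + 1) : FQCFr N K η c j = FQCFr N K η d j := by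
  unfold FQCFr
  split_ifs
  · rw [hcd j (by omega) (by omega)]
  · rw [hcd (j-1) (by omega) (by omega)]
  · rw [hcd j (by omega) (by omega), hcd (j-1) (by omega) (by omega),
      hcd (j+1) (by omega) (by omega), hcd (j-2) (by omega) (by omega)]
  · rw [hcd j (by omega) (by omega), hcd (j-1) (by omega) (by omega)]

/-- The even extension to `ℤ` of a vector indexed by `0, …, N`. -/
def evenExt (N : ℕ) (x : Fin (N+1) → ℝ) (j : ℤ) : ℝ :=
  x ⟨min j.natAbs N, by omega⟩

theorem evenExt_neg (N : ℕ) (x : Fin (N+1) → ℝ) (j : ℤ) :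
    evenExt N x (-j) = evenExt N x j := by
  simp [evenExt]

theorem evenExt_natCast {N : ℕ} (x : Fin (N+1) → ℝ) (k : Fin (N+1)) :
    evenExt N x (k : ℕ) = x k := by
  unfold evenExt
  congr 1
  ext
  simp only [Int.natAbs_natCast]
  omega

theorem vcomp_sub {N : ℕ} (r : Fin (2*N+1) → ℝ) (i : Fin (2*N+1)) :
    vcomp N r ((i : ℕ) - N) = r i := by
  simp [vcomp, i.2]

theorem vcomp_evenExt {N : ℕ} (x : Fin (N+1) → ℝ) {j : ℤ} (h1 : -(N:ℤ) ≤ j) (h2 : j ≤ N) :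
    vcomp N (fun i => evenExt N x ((i : ℕ) - N)) j = evenExt N x j := by
  unfold vcomp
  rw [dif_pos (by omega)]
  dsimp only
  congr 1
  omega

theorem SymVec.vcomp_eq {N : ℕ} {r : Fin (2*N+1) → ℝ} (hr : SymVec N r) {j : ℤ}
    (h1 : -(N:ℤ) ≤ j) (h2 : j ≤ N) :
    vcomp N r j = evenExt N (fun k => vcomp N r (k : ℕ)) j := by
  unfold evenExt
  dsimp only
  rcases le_or_gt 0 j with h | h
  · congr 1; omega
  · have := hr (-j) (by omega) (by omega)
    rw [neg_neg] at this
    rw [this]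
    congr 1
    omega

/-- Existence and uniqueness for a force law which is stiff at nearest-neighbour distances and
weakly decreasing at next-nearest-neighbour distances. -/
theorem existsUnique_symmetric_equilibrium {N K : ℕ} (hK : 1 ≤ K) (hKN : K < N) {η : ℝ → ℝ}
    {a b L C : ℝ} (hab : a ≤ b) (hC : 0 ≤ C) (hCL : 12 * C < L)
    (hηc : ContinuousOn η (Set.Icc a b))
    (hη : ∀ x ∈ Set.Icc a b, ∀ y ∈ Set.Icc a b, x ≤ y → L * (y - x) ≤ η y - η x)
    (hη2 : ∀ x ∈ Set.Icc (2*a) (2*b), ∀ y ∈ Set.Icc (2*a) (2*b), x ≤ y →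
      -C * (y - x) ≤ η y - η x ∧ η y ≤ η x)
    {f : ℤ → ℝ} (hsum : ∑ j ∈ Finset.Icc (-(N:ℤ)) ((N:ℤ)+1), f j = 0)
    (hanti : ∀ j : ℤ, 0 ≤ j → j ≤ (N:ℤ) → f (j+1) = - f (-j))
    (hΦ : ∀ j : ℤ, -(N:ℤ) ≤ j → j ≤ (N:ℤ) →
      η a + 4*η (2*a) - 2*η (2*b) < -(∑ i ∈ Finset.Icc (-(N:ℤ)) j, f i) ∧
      -(∑ i ∈ Finset.Icc (-(N:ℤ)) j, f i) < η b + 4*η (2*b) - 2*η (2*a)) :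
    ∃! r : Fin (2*N+1) → ℝ, (∀ k, r k ∈ Set.Ioo a b) ∧ SymVec N r ∧
      ∀ j : ℤ, -(N:ℤ) ≤ j → j ≤ (N:ℤ)+1 → FQCFr N K η (vcomp N r) j + f j = 0 := by
  have lip : ∀ s t s' t' d : ℝ, s ∈ Set.Icc a b → t ∈ Set.Icc a b → s' ∈ Set.Icc a b →
      t' ∈ Set.Icc a b → |s - s'| ≤ d → |t - t'| ≤ d →
      |η (s + t) - η (s' + t')| ≤ 2 * (C * d) := by
    intro s t s' t' d hs ht hs' ht' h1 h2
    have m1 : s + t ∈ Set.Icc (2*a) (2*b) :=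
      ⟨by linarith [hs.1, ht.1], by linarith [hs.2, ht.2]⟩
    have m2 : s' + t' ∈ Set.Icc (2*a) (2*b) :=
      ⟨by linarith [hs'.1, ht'.1], by linarith [hs'.2, ht'.2]⟩
    rw [abs_le] at h1 h2
    rw [abs_le]
    rcases le_total (s + t) (s' + t') with h | h
    · obtain ⟨h3, h4⟩ := hη2 _ m1 _ m2 h
      constructor <;> nlinarith
    · obtain ⟨h3, h4⟩ := hη2 _ m2 _ m1 h
      constructor <;> nlinarith
  have range : ∀ s t : ℝ, s ∈ Set.Icc a b → t ∈ Set.Icc a b →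
      η (2*b) ≤ η (s + t) ∧ η (s + t) ≤ η (2*a) := by
    intro s t hs ht
    have m1 : s + t ∈ Set.Icc (2*a) (2*b) :=
      ⟨by linarith [hs.1, ht.1], by linarith [hs.2, ht.2]⟩
    exact ⟨(hη2 _ m1 _ ⟨by linarith, le_rfl⟩ m1.2).2, (hη2 _ ⟨le_rfl, by linarith⟩ _ m1 m1.1).2⟩
  have hη2ab : η (2*b) ≤ η (2*a) :=
    (hη2 _ ⟨le_rfl, by linarith⟩ _ ⟨by linarith, le_rfl⟩ (by linarith)).2
  obtain ⟨x, ⟨hx, hxe⟩, hxu⟩ := existsUnique_of_diagonal_dominance (ι := Fin (N+1)) hab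
    (mul_nonneg (by norm_num) hC) hCL hηc hη
    (fun x k => farForce K η (evenExt N x) (k : ℕ))
    (fun k => -∑ i ∈ Finset.Icc (-(N:ℤ)) ((k : ℕ) : ℤ), f i)
    (by
      intro x y hx hy k
      have hd : ∀ j, |evenExt N x j - evenExt N y j| ≤ dist x y := fun j =>
        dist_le_pi_dist x y _
      have B : ∀ i j, |η (evenExt N x i + evenExt N x j) - η (evenExt N y i + evenExt N y j)|
          ≤ 2 * (C * dist x y) := fun i j =>
        lip _ _ _ _ _ (hx _) (hx _) (hy _) (hy _) (hd i) (hd j)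
      have hCd : 0 ≤ C * dist x y := mul_nonneg hC dist_nonneg
      simp only [farForce, two_mul (evenExt _ _ _)]
      generalize ((k : ℕ) : ℤ) = j
      split_ifs
      · have h1 := abs_le.1 (B j (j-1))
        have h2 := abs_le.1 (B j (j+1))
        have h3 := abs_le.1 (B K K)
        have h4 := abs_le.1 (B K (K-1))
        have h5 := abs_le.1 (B K (K+1))
        rw [abs_le]
        constructor <;> linarith [h1.1, h1.2, h2.1, h2.2, h3.1, h3.2, h4.1, h4.2, h5.1, h5.2]
      · have h1 := abs_le.1 (B j j)
        rw [abs_le]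
        constructor <;> linarith [h1.1, h1.2])
    (by
      intro x hx k
      have B : ∀ i j, η (2*b) ≤ η (evenExt N x i + evenExt N x j) ∧
          η (evenExt N x i + evenExt N x j) ≤ η (2*a) := fun i j => range _ _ (hx _) (hx _)
      obtain ⟨p1, p2⟩ := hΦ (k : ℕ) (by omega) (by omega)
      simp only [farForce, two_mul (evenExt _ _ _)]
      generalize ((k : ℕ) : ℤ) = j at *
      split_ifs
      · have h1 := B j (j-1)
        have h2 := B j (j+1)
        have h3 := B K K
        have h4 := B K (K-1)
        have h5 := B K (K+1)
        constructor <;> linarith [h1.1, h1.2, h2.1, h2.2, h3.1, h3.2, h4.1, h4.2, h5.1, h5.2]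
      · have h1 := B j j
        constructor <;> linarith [h1.1, h1.2])
  refine ⟨fun i => evenExt N x ((i : ℕ) - N), ⟨fun k => hx _, ?_, ?_⟩, ?_⟩
  · intro j h1 h2
    rw [vcomp_evenExt x (by omega) (by omega), vcomp_evenExt x (by omega) (by omega),
      evenExt_neg]
  · intro j h1 h2
    rw [FQCFr_congr hKN (fun j => vcomp_evenExt x) h1 h2]
    revert j
    rw [equilibrium_iff hK hKN (evenExt_neg N x) hsum hanti]
    intro k hk
    have := hxe ⟨k, by omega⟩
    rwa [← evenExt_natCast x] at this
  · rintro r ⟨hr, hsym, hre⟩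
    have hmem : ∀ k : Fin (N+1), vcomp N r (k : ℕ) ∈ Set.Ioo a b := by
      intro k
      unfold vcomp
      rw [dif_pos (by omega)]
      exact hr _
    have hrx : (fun k : Fin (N+1) => vcomp N r (k : ℕ)) = x := by
      refine hxu _ ⟨hmem, fun k => ?_⟩
      have h := (equilibrium_iff (η := η) hK hKN
        (evenExt_neg N fun k : Fin (N+1) => vcomp N r (k : ℕ)) hsum hanti).1
        (fun j h1 h2 => by
          rw [← FQCFr_congr hKN (fun j => hsym.vcomp_eq) h1 h2]; exact hre j h1 h2) k (by omega)
      rwa [evenExt_natCast] at h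
    ext i
    rw [← hrx, ← hsym.vcomp_eq (by omega) (by omega), vcomp_sub]

theorem hasDerivAt_lennardJones {r : ℝ} (hr : 0 < r) :
    HasDerivAt (fun r : ℝ => 1/r^12 - 2/r^6) (12/r^7 - 12/r^13) r := by
  have h1 := (hasDerivAt_const r (1:ℝ)).fun_div (hasDerivAt_pow 12 r) (by positivity)
  have h2 := (hasDerivAt_const r (2:ℝ)).fun_div (hasDerivAt_pow 6 r) (by positivity)
  refine (h1.fun_sub h2).congr_deriv ?_
  field_simp
  ring

theorem hasDerivAt_deriv_lennardJones {r : ℝ} (hr : 0 < r) :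
    HasDerivAt (deriv fun r : ℝ => 1/r^12 - 2/r^6) ((1/r)^8 * (156 * (1/r)^6 - 84)) r := by
  have h1 := (hasDerivAt_const r (12:ℝ)).fun_div (hasDerivAt_pow 7 r) (by positivity)
  have h2 := (hasDerivAt_const r (12:ℝ)).fun_div (hasDerivAt_pow 13 r) (by positivity)
  have h3 := h1.fun_sub h2
  have h4 : (deriv fun r : ℝ => 1/r^12 - 2/r^6) =ᶠ[nhds r] fun r => 12/r^7 - 12/r^13 := by
    filter_upwards [lt_mem_nhds hr] with s hs
    exact (hasDerivAt_lennardJones hs).deriv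
  refine (h3.congr_of_eventuallyEq h4).congr_deriv ?_
  field_simp
  ring

/-- Corollary for the Lennard-Jones potential: with `r̃₂ = (13/4)^{1/6}`,
`a₁ = (53261/29120)^{1/6}`, any `r_U ∈ (r̃₂/2, a₁)`, and
`r_L = max(r̃₂/2, (63/(16η'(r_U)))^{1/8})`, if `r_L < r_U` then for anti-symmetric external
forces with conjugate forces in the stated range the equilibrium equations have exactly one
symmetric solution in `Ω = (r_L, r_U)^{2N+1}`. -/
theorem lennardJones_equilibrium_unique_symmetric_solution
    (N K : ℕ) (hK : 2 ≤ K) (hKN : K + 2 ≤ N)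
    (φ : ℝ → ℝ) (hφ : φ = fun r => 1/r^12 - 2/r^6)
    (η : ℝ → ℝ) (hη : η = deriv φ)
    (r2 a1 : ℝ) (hr2 : r2 = ((13:ℝ)/4) ^ ((1:ℝ)/6))
    (ha1 : a1 = ((53261:ℝ)/29120) ^ ((1:ℝ)/6))
    (rU rL : ℝ) (hrU1 : r2/2 < rU) (hrU2 : rU < a1)
    (hrL : rL = max (r2/2) ((63 / (16 * deriv η rU)) ^ ((1:ℝ)/8)))
    (hLU : rL < rU)
    (f : ℤ → ℝ)
    (hsum : ∑ j ∈ Finset.Icc (-(N:ℤ)) ((N:ℤ)+1), f j = 0)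
    (hanti : ∀ j : ℤ, 0 ≤ j → j ≤ (N:ℤ) → f (j+1) = - f (-j))
    (hΦ : ∀ j : ℤ, -(N:ℤ) ≤ j → j ≤ (N:ℤ) →
      η rL + 4*η (2*rL) - 2*η (2*rU) < -(∑ i ∈ Finset.Icc (-(N:ℤ)) j, f i) ∧
      -(∑ i ∈ Finset.Icc (-(N:ℤ)) j, f i) < η rU + 4*η (2*rU) - 2*η (2*rL)) :
    ∃! r : Fin (2*N+1) → ℝ, (∀ k, r k ∈ Ioo rL rU) ∧ SymVec N r ∧
      ∀ j : ℤ, -(N:ℤ) ≤ j → j ≤ (N:ℤ)+1 → FQCFr N K η (vcomp N r) j + f j = 0 := by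
  subst hφ
  have hd : ∀ r : ℝ, 0 < r → HasDerivAt η ((1/r)^8 * (156 * (1/r)^6 - 84)) r := by
    subst hη
    exact fun r hr => hasDerivAt_deriv_lennardJones hr
  have hr2pos : 0 < r2 := by rw [hr2]; positivity
  have hr2pow : r2^6 = 13/4 := by
    rw [hr2, ← Real.rpow_natCast, ← Real.rpow_mul (by norm_num)]; norm_num
  have ha1pow : a1^6 = 53261/29120 := by
    rw [ha1, ← Real.rpow_natCast, ← Real.rpow_mul (by norm_num)]; norm_num
  have hrL1 : r2/2 ≤ rL := hrL ▸ le_max_left _ _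
  have hrLpos : 0 < rL := by linarith
  have hrUpos : 0 < rU := by linarith
  have hrU6 : rU^6 < 53261/29120 := ha1pow ▸ pow_lt_pow_left₀ hrU2 hrUpos.le (by norm_num)
  have hnear : 0 < 156 * (1/rU)^6 - 84 := by
    have : (84/156 : ℝ) < 1 / rU^6 := by
      rw [lt_div_iff₀ (by positivity)]; linarith
    rw [one_div_pow]; linarith
  have hLd := (hd rU hrUpos).deriv
  have hLpos : 0 < deriv η rU := by rw [hLd]; positivity
  have hrL8 : 63 / (16 * deriv η rU) ≤ rL^8 := by
    have h : (63 / (16 * deriv η rU)) ^ ((1:ℝ)/8) ≤ rL := hrL ▸ le_max_right _ _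
    have h' := pow_le_pow_left₀ (by positivity) h 8
    rwa [← Real.rpow_natCast, ← Real.rpow_mul (by positivity),
      show (1:ℝ)/8 * (8:ℕ) = 1 by norm_num, Real.rpow_one] at h'
  have hfar : ∀ s, 2*rL ≤ s → (1/s)^6 ≤ 4/13 := by
    intro s hs
    have h := pow_le_pow_left₀ hr2pos.le (show r2 ≤ s by linarith) 6
    rw [hr2pow] at h
    rw [one_div_pow, div_le_iff₀ (by linarith)]
    linarith
  have hcont : ∀ a b : ℝ, 0 < a → ContinuousOn η (Set.Icc a b) := fun a b ha x hx =>
    (hd x (ha.trans_le hx.1)).continuousAt.continuousWithinAt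
  have hdiff : ∀ a b : ℝ, 0 < a → DifferentiableOn ℝ η (interior (Set.Icc a b)) :=
    fun a b ha x hx =>
      (hd x (ha.trans_le (interior_subset hx).1)).differentiableAt.differentiableWithinAt
  have hC : 0 ≤ (1/(2*rL))^8 * (84 - 156 * (1/(2*rU))^6) :=
    mul_nonneg (by positivity) (by linarith [hfar (2*rU) (by linarith)])
  refine existsUnique_symmetric_equilibrium (a := rL) (b := rU) (L := deriv η rU)
    (C := (1/(2*rL))^8 * (84 - 156 * (1/(2*rU))^6)) (by omega) (by omega) hLU.le hC ?_
    (hcont _ _ hrLpos) ?_ ?_ hsum hanti hΦ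
  · have h1 : 63 / (16 * rL^8) ≤ deriv η rU := by
      rw [div_le_iff₀ (by positivity)] at hrL8 ⊢
      linarith
    have h2 : 63 / (16 * rL^8) = 12 * ((1/(2*rL))^8 * 84) := by field_simp; norm_num
    have h3 : 0 < (1/(2*rL))^8 * (1/(2*rU))^6 := by positivity
    linarith
  · refine (convex_Icc _ _).mul_sub_le_image_sub_of_le_deriv (hcont _ _ hrLpos)
      (hdiff _ _ hrLpos) fun x hx => ?_
    have hx := interior_subset hx
    have hxpos : 0 < x := hrLpos.trans_le hx.1
    have hinv : 1/rU ≤ 1/x := one_div_le_one_div_of_le hxpos hx.2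
    rw [hLd, (hd x hxpos).deriv]
    gcongr
  · have h2L : 0 < 2*rL := by linarith
    have hbound : ∀ x ∈ interior (Set.Icc (2*rL) (2*rU)),
        -((1/(2*rL))^8 * (84 - 156 * (1/(2*rU))^6)) ≤ deriv η x ∧ deriv η x ≤ 0 := by
      intro x hx
      have hx := interior_subset hx
      have hxpos : 0 < x := h2L.trans_le hx.1
      have h6 := hfar x hx.1
      have i1 : (1/x)^8 ≤ (1/(2*rL))^8 := by gcongr; exact hx.1
      have i2 : (1/(2*rU))^6 ≤ (1/x)^6 := by gcongr; exact hx.2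
      rw [(hd x hxpos).deriv]
      constructor
      · have := mul_le_mul i1 (show 84 - 156 * (1/x)^6 ≤ 84 - 156 * (1/(2*rU))^6 by linarith)
          (by linarith) (by positivity)
        linarith
      · exact mul_nonpos_of_nonneg_of_nonpos (by positivity) (by linarith)
    intro x hx y hy hxy
    refine ⟨(convex_Icc _ _).mul_sub_le_image_sub_of_le_deriv (hcont _ _ h2L) (hdiff _ _ h2L)
      (fun x hx => (hbound x hx).1) x hx y hy hxy, ?_⟩
    have := (convex_Icc _ _).image_sub_le_mul_sub_of_deriv_le (hcont _ _ h2L) (hdiff _ _ h2L)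
      (fun x hx => (hbound x hx).2) x hx y hy hxy
    linarith
end
end
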